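/- Fix integers k ≥ 1, L ≥ 2 and set N = (L+1)k. For each ℓ = 1,…,L let Σ_ℓ be a 2k×2k real symmetric positive-definite matrix. Define the primal normalization constant Z = ∫_{ℝ^N} ∏_{ℓ=1}^{L} det(2πΣ_ℓ)^{-1/2} exp(−(1/2) [x_{(ℓ−1)k+1},…,x_{(ℓ+1)k}] Σ_ℓ⁻¹ [x_{(ℓ−1)k+1},…,x_{(ℓ+1)k}]ᵀ) dx, and the dual normalization constant Z' = (2π)^{2k} ∫_{ℝ^{(L−1)k}} ∏_{ℓ=1}^{L} exp(−(1/2) v_ℓᵀ Σ_ℓ v_ℓ) dω, where ω = (ω_{k+1},…,ω_{Lk}) and v_ℓ = (−ω_{(ℓ−1)k+1},…,−ω_{ℓk}, ω_{ℓk+1},…,ω_{(ℓ+1)k}) with the boundary values ω_1 = … = ω_k = ω_{Lk+1} = … = ω_{(L+1)k} = 0. Then both integrals converge and Z' = (2π)^N Z. -/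

import Mathlib

open Matrix MeasureTheory Real

/-- The global index (in `{0, …, (L+1)k − 1}`) of the `i`-th variable of block `ℓ`
(block `ℓ` occupies coordinates `(ℓ−1)k+1, …, (ℓ+1)k` in 1-indexed notation). -/
def blockIdx {k L : ℕ} (ℓ : Fin L) (i : Fin (2*k)) : Fin ((L+1)*k) :=
  ⟨(ℓ:ℕ)*k + (i:ℕ), by
    have h1 : (ℓ:ℕ) + 1 ≤ L := ℓ.isLt
    have h2 : (i:ℕ) < 2*k := i.isLt
    have h3 : ((ℓ:ℕ)+2)*k ≤ (L+1)*k := Nat.mul_le_mul_right k (by omega)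
    have h4 : ((ℓ:ℕ)+2)*k = (ℓ:ℕ)*k + 2*k := by ring
    omega⟩

/-- Extension of a vector of the `(L−1)k` interior dual variables
`ω_{k+1}, …, ω_{Lk}` to all `(L+1)k` coordinates, the `2k` boundary variables
`ω_1, …, ω_k, ω_{Lk+1}, …, ω_{(L+1)k}` being set to zero. -/
noncomputable def extZero (k L : ℕ) (ω : Fin ((L-1)*k) → ℝ) : Fin ((L+1)*k) → ℝ :=
  fun i =>
    if h : k ≤ (i:ℕ) ∧ (i:ℕ) < L*k then
      ω ⟨(i:ℕ) - k, by
        have h2 : L * k ≤ (L - 1) * k + k := by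
          cases L with
          | zero => simp
          | succ n => simp [Nat.succ_sub_one, Nat.succ_mul]
        omega⟩
    else 0

/-- The `ℓ`-th sign-inverted dual block vector
`v_ℓ = (−ω_{(ℓ−1)k+1}, …, −ω_{ℓk}, ω_{ℓk+1}, …, ω_{(ℓ+1)k})`, with boundary
values set to zero. -/
noncomputable def dualBlock (k L : ℕ) (ω : Fin ((L-1)*k) → ℝ) (ℓ : Fin L) :
    Fin (2*k) → ℝ :=
  fun j => if (j:ℕ) < k then -(extZero k L ω (blockIdx ℓ j))
           else extZero k L ω (blockIdx ℓ j)

open scoped MatrixOrder in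
/-- The unnormalized centred Gaussian density with precision matrix `M` is integrable, with
integral `(2π)^{n/2} / √(det M)`. -/
theorem integrable_and_integral_exp_neg_half_quadratic {ι : Type*} [Fintype ι] [DecidableEq ι]
    {M : Matrix ι ι ℝ} (hM : M.PosDef) :
    Integrable (fun x : ι → ℝ => Real.exp (-(1/2) * (x ⬝ᵥ M *ᵥ x))) ∧
    ∫ x : ι → ℝ, Real.exp (-(1/2) * (x ⬝ᵥ M *ᵥ x)) =
      √(2 * π) ^ Fintype.card ι / √M.det := by
  obtain ⟨C, hC⟩ := CStarAlgebra.nonneg_iff_eq_star_mul_self.mp hM.posSemidef.nonneg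
  have hC' : M = Cᵀ * C := by simpa [star_eq_conjTranspose] using hC
  have hdetM : M.det = C.det ^ 2 := by rw [hC', det_mul, det_transpose, sq]
  have hdet : C.det ≠ 0 := by
    intro h
    have := hM.det_pos
    simp [hdetM, h] at this
  set g : (ι → ℝ) → ℝ := fun y => ∏ i, Real.exp (-(1/2) * (y i) ^ 2) with hg
  have hfg : (fun x : ι → ℝ => Real.exp (-(1/2) * (x ⬝ᵥ M *ᵥ x))) = g ∘ toLin' C := by
    funext x
    simp only [hg, Function.comp_apply, toLin'_apply, ← Real.exp_sum, ← Finset.mul_sum]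
    rw [hC', ← mulVec_mulVec, dotProduct_mulVec, vecMul_transpose]
    simp [dotProduct, sq]
  have hgi : Integrable g :=
    Integrable.fintype_prod (f := fun (_ : ι) (t : ℝ) => Real.exp (-(1/2) * t ^ 2))
      (fun _ => integrable_exp_neg_mul_sq (by norm_num))
  have hmap := Real.map_matrix_volume_pi_eq_smul_volume_pi hdet
  have hmeas : AEMeasurable (toLin' C) (volume : Measure (ι → ℝ)) :=
    (LinearMap.continuous_of_finiteDimensional (toLin' C)).aemeasurable
  have hgm : Integrable g (Measure.map (toLin' C) volume) := by
    rw [hmap]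
    exact hgi.smul_measure ENNReal.ofReal_ne_top
  refine ⟨hfg ▸ hgm.comp_aemeasurable hmeas, ?_⟩
  have hint := integral_map hmeas hgm.aestronglyMeasurable
  rw [hfg]
  change ∫ x, g (toLin' C x) = _
  rw [← hint, hmap, integral_smul_measure, hg,
    integral_fintype_prod_volume_eq_pow (ι := ι) (fun t : ℝ => Real.exp (-(1/2) * t ^ 2)),
    integral_gaussian, hdetM, Real.sqrt_sq_eq_abs, ENNReal.toReal_ofReal (abs_nonneg _),
    abs_inv, smul_eq_mul, div_eq_inv_mul (_ ^ _)]
  congr 3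
  ring

theorem Matrix.mulVec_injective_of_det_transpose_mul_self_ne_zero {m n : Type*} [Fintype m]
    [Fintype n] [DecidableEq n] {A : Matrix m n ℝ} (h : (Aᵀ * A).det ≠ 0) :
    Function.Injective A.mulVec := by
  have hinj := mulVec_injective_of_isUnit
    ((isUnit_iff_isUnit_det _).2 (isUnit_iff_ne_zero.2 h))
  intro x y hxy
  apply hinj
  simp only [← mulVec_mulVec]
  exact congrArg _ hxy

/-- If the columns of `A` and `B` span complementary orthogonal subspaces and have equal Gram
determinants, then the determinants of the forms `S⁻¹` and `S` restricted to these subspaces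
differ by the factor `det S`. -/
theorem Matrix.det_transpose_mul_inv_mul_mul_det {m n p : Type*} [Fintype m] [Fintype n]
    [Fintype p] [DecidableEq m] [DecidableEq n] [DecidableEq p] (e : n ⊕ p ≃ m)
    {A : Matrix m n ℝ} {B : Matrix m p ℝ} {S : Matrix m m ℝ} (hS : S.PosDef)
    (hAB : Aᵀ * B = 0) (hgram : (Aᵀ * A).det = (Bᵀ * B).det) (hA : (Aᵀ * A).det ≠ 0) :
    (Aᵀ * S⁻¹ * A).det * S.det = (Bᵀ * S * B).det := by
  have hSu : IsUnit S.det := isUnit_iff_ne_zero.2 hS.det_pos.ne'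
  have hSt : Sᵀ = S := by simpa using hS.isHermitian.eq
  have hBA : Bᵀ * A = 0 := by simpa using congrArg transpose hAB
  set M : Matrix m m ℝ := (fromCols A (S * B)).submatrix id e.symm with hMdef
  set K : Matrix m m ℝ := (fromCols A B).submatrix id e.symm with hKdef
  have key (X Y : Matrix m (n ⊕ p) ℝ) (Q : Matrix m m ℝ) :
      (X.submatrix id e.symm).det * Q.det * (Y.submatrix id e.symm).det
        = (Xᵀ * Q * Y).det := by
    rw [← det_transpose (X.submatrix id e.symm), ← det_mul, ← det_mul,
      ← det_submatrix_equiv_self e.symm (Xᵀ * Q * Y)]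
    rfl
  have h1 : M.det * S⁻¹.det * M.det = (Aᵀ * S⁻¹ * A).det * (Bᵀ * S * B).det := by
    have h12 : Aᵀ * S⁻¹ * (S * B) = 0 := by
      rw [Matrix.mul_assoc, ← Matrix.mul_assoc S⁻¹, nonsing_inv_mul _ hSu, Matrix.one_mul, hAB]
    have h22 : Bᵀ * S * S⁻¹ * (S * B) = Bᵀ * S * B := by
      rw [mul_nonsing_inv_cancel_right _ _ hSu, Matrix.mul_assoc]
    rw [hMdef, key, transpose_fromCols, fromRows_mul, fromRows_mul_fromCols, h12,
      det_fromBlocks_zero₁₂, transpose_mul, hSt, h22]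
  have h2 : K.det * M.det = (Aᵀ * A).det * (Bᵀ * S * B).det := by
    have := key (fromCols A B) (fromCols A (S * B)) 1
    rw [det_one, mul_one, Matrix.mul_one, transpose_fromCols, fromRows_mul_fromCols, hBA,
      det_fromBlocks_zero₂₁, ← Matrix.mul_assoc Bᵀ] at this
    exact this
  have h3 : K.det * K.det = (Aᵀ * A).det * (Bᵀ * B).det := by
    have := key (fromCols A B) (fromCols A B) 1
    rw [det_one, mul_one, Matrix.mul_one, transpose_fromCols, fromRows_mul_fromCols, hBA,
      det_fromBlocks_zero₂₁] at this
    exact this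
  have hQ : (Bᵀ * S * B).det ≠ 0 := by
    have := (hS.conjTranspose_mul_mul_same
      (mulVec_injective_of_det_transpose_mul_self_ne_zero (hgram ▸ hA))).det_pos
    simpa using this.ne'
  have hSS : S⁻¹.det * S.det = 1 := by rw [← det_mul, nonsing_inv_mul _ hSu, det_one]
  rw [← hgram] at h3
  have hMM : M.det * M.det = (Bᵀ * S * B).det * (Bᵀ * S * B).det := by
    have hG : (Aᵀ * A).det * (Aᵀ * A).det ≠ 0 := mul_ne_zero hA hA
    apply mul_left_cancel₀ hG
    linear_combination (K.det * M.det + (Aᵀ * A).det * (Bᵀ * S * B).det) * h2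
      - M.det * M.det * h3
  apply mul_right_cancel₀ hQ
  linear_combination -S.det * h1 + M.det * M.det * hSS + hMM

theorem Matrix.dotProduct_blockDiagonal_mulVec {m o : Type*} [Fintype m] [Fintype o]
    [DecidableEq o] (S : o → Matrix m m ℝ) (x : m × o → ℝ) :
    x ⬝ᵥ blockDiagonal S *ᵥ x = ∑ l, (fun i => x (i, l)) ⬝ᵥ S l *ᵥ (fun i => x (i, l)) := by
  simp only [dotProduct, mulVec, Fintype.sum_prod_type, blockDiagonal_apply]
  rw [Finset.sum_comm]
  simp

theorem Matrix.PosDef.blockDiagonal {m o : Type*} [Fintype m] [Fintype o] [DecidableEq o]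
    {S : o → Matrix m m ℝ} (hS : ∀ l, (S l).PosDef) : (blockDiagonal S).PosDef := by
  refine .of_dotProduct_mulVec_pos ?_ fun x hx => ?_
  · rw [IsHermitian, blockDiagonal_conjTranspose]
    exact congrArg _ (funext fun l => (hS l).isHermitian.eq)
  · rw [star_trivial, dotProduct_blockDiagonal_mulVec]
    obtain ⟨⟨i, l⟩, hil⟩ := Function.ne_iff.1 hx
    refine Finset.sum_pos' (fun l _ => ?_) ⟨l, Finset.mem_univ _, ?_⟩
    · simpa using (hS l).posSemidef.dotProduct_mulVec_nonneg (fun i => x (i, l))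
    · simpa using (hS l).dotProduct_mulVec_pos (x := fun i => x (i, l))
        (Function.ne_iff.2 ⟨i, hil⟩)

/-- The `0`-`1` matrix sending the vector of all variables to its stacked blocks. -/
def blockMatrix (k L : ℕ) : Matrix (Fin (2*k) × Fin L) (Fin ((L+1)*k)) ℝ :=
  Matrix.of fun p n => if blockIdx p.2 p.1 = n then 1 else 0

/-- The diagonal matrix with entries `s` on the first half and `t` on the second half of each
block. -/
def halfWeights (k L : ℕ) (s t : ℝ) :
    Matrix (Fin (2*k) × Fin L) (Fin (2*k) × Fin L) ℝ :=
  Matrix.diagonal fun p => if (p.1 : ℕ) < k then s else t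

/-- The position of the interior variables among all variables. -/
def interiorIdx (k L : ℕ) (hL : 1 ≤ L) (m : Fin ((L-1)*k)) : Fin ((L+1)*k) :=
  ⟨k + m, by
    obtain ⟨l, rfl⟩ := Nat.exists_eq_add_of_le' hL
    have := m.isLt
    simp only [Nat.add_sub_cancel, Nat.add_mul, one_mul] at *
    omega⟩

/-- The matrix sending the interior dual variables to their stacked sign-inverted blocks. -/
def dualMatrix (k L : ℕ) (hL : 1 ≤ L) : Matrix (Fin (2*k) × Fin L) (Fin ((L-1)*k)) ℝ :=
  halfWeights k L (-1) 1 * (blockMatrix k L).submatrix id (interiorIdx k L hL)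

theorem sum_range_blocks (k L : ℕ) (s t : ℝ) (g : ℕ → ℝ) :
    ∑ l ∈ Finset.range L, ∑ i ∈ Finset.range (2*k), (if i < k then s else t) * g (l*k + i)
      = ∑ n ∈ Finset.range ((L+1)*k),
          ((if n < L*k then s else 0) + (if k ≤ n then t else 0)) * g n := by
  have hblock (l : ℕ) :
      ∑ i ∈ Finset.range (2*k), (if i < k then s else t) * g (l*k + i)
        = ∑ i ∈ Finset.range k, s * g (l*k + i)
          + ∑ i ∈ Finset.range k, t * g (k + (l*k + i)) := by
    rw [two_mul, Finset.sum_range_add]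
    congr 1
    · refine Finset.sum_congr rfl fun i hi => ?_
      rw [if_pos (Finset.mem_range.1 hi)]
    · refine Finset.sum_congr rfl fun i _ => ?_
      rw [if_neg (by omega), Nat.add_left_comm]
  have hsum (g : ℕ → ℝ) : ∑ l ∈ Finset.range L, ∑ i ∈ Finset.range k, g (l*k + i)
      = ∑ n ∈ Finset.range (L*k), g n := by
    induction L with
    | zero => simp
    | succ L ih => rw [Finset.sum_range_succ, ih, Nat.succ_mul, Finset.sum_range_add]
  simp only [hblock, Finset.sum_add_distrib, add_mul]
  rw [hsum (fun n => s * g n), hsum (fun n => t * g (k + n))]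
  congr 1
  · rw [one_mul, Finset.sum_range_add]
    rw [Finset.sum_eq_zero (s := Finset.range k) (fun i _ => by simp), add_zero]
    refine Finset.sum_congr rfl fun i hi => ?_
    rw [if_pos (Finset.mem_range.1 hi)]
  · rw [one_mul, add_comm (L*k), Finset.sum_range_add]
    rw [Finset.sum_eq_zero (s := Finset.range k), zero_add]
    · simp
    · intro i hi
      rw [if_neg (by simpa using hi), zero_mul]

theorem transpose_blockMatrix_mul_halfWeights_mul (k L : ℕ) (s t : ℝ) :
    (blockMatrix k L)ᵀ * halfWeights k L s t * blockMatrix k L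
      = diagonal fun n : Fin ((L+1)*k) =>
          (if (n:ℕ) < L*k then s else 0) + (if k ≤ (n:ℕ) then t else 0) := by
  ext a b
  set g : ℕ → ℝ := fun n => (if n = (a:ℕ) then 1 else 0) * (if n = (b:ℕ) then 1 else 0) with hg
  have hL : ((blockMatrix k L)ᵀ * halfWeights k L s t * blockMatrix k L) a b
      = ∑ l ∈ Finset.range L, ∑ i ∈ Finset.range (2*k),
          (if i < k then s else t) * g (l*k + i) := by
    rw [halfWeights, Matrix.mul_apply, Fintype.sum_prod_type, Finset.sum_comm]
    simp only [Finset.sum_range, mul_diagonal, transpose_apply, blockMatrix, of_apply, hg,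
      Fin.ext_iff, blockIdx]
    exact Finset.sum_congr rfl fun l _ => Finset.sum_congr rfl fun i _ => by ring
  rw [hL, sum_range_blocks, Finset.sum_range, Finset.sum_eq_single a]
  · by_cases hab : a = b
    · subst hab; simp [hg]
    · have : (a:ℕ) ≠ b := fun h => hab (Fin.ext h)
      simp [hg, hab, this]
  · intro n _ hn
    have : (n:ℕ) ≠ a := fun h => hn (Fin.ext h)
    simp [hg, this]
  · simp

theorem transpose_blockMatrix_mul_self (k L : ℕ) :
    (blockMatrix k L)ᵀ * blockMatrix k L
      = diagonal fun n : Fin ((L+1)*k) =>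
          (if (n:ℕ) < L*k then 1 else 0) + (if k ≤ (n:ℕ) then 1 else 0) := by
  have h : halfWeights k L 1 1 = 1 := by simp [halfWeights]
  rw [← transpose_blockMatrix_mul_halfWeights_mul, h, Matrix.mul_one]

theorem det_transpose_blockMatrix_mul_self (k L : ℕ) (hL : 1 ≤ L) :
    ((blockMatrix k L)ᵀ * blockMatrix k L).det = 2 ^ ((L-1)*k) := by
  obtain ⟨l, rfl⟩ := Nat.exists_eq_add_of_le' hL
  rw [transpose_blockMatrix_mul_self, det_diagonal,
    ← Finset.prod_range (fun n =>
      ((if n < (l+1)*k then 1 else 0) + (if k ≤ n then 1 else 0) : ℝ)),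
    show (l + 1 + 1) * k = k + l * k + k by ring, Finset.prod_range_add, Finset.prod_range_add,
    Finset.prod_eq_one (s := Finset.range k), Finset.prod_eq_one (s := Finset.range k), one_mul,
    mul_one, Nat.add_sub_cancel, Finset.prod_congr rfl (g := fun _ => (2:ℝ))]
  · simp
  all_goals
    intro i hi
    have hi := Finset.mem_range.1 hi
    simp only [Nat.add_mul, one_mul]
    split_ifs <;> first | omega | norm_num

theorem transpose_dualMatrix_mul_self (k L : ℕ) (hL : 1 ≤ L) :
    (dualMatrix k L hL)ᵀ * dualMatrix k L hL = diagonal fun _ => 2 := by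
  have hW : (halfWeights k L (-1) 1)ᵀ * halfWeights k L (-1) 1 = 1 := by
    rw [halfWeights, diagonal_transpose, diagonal_mul_diagonal, ← diagonal_one]
    congr 1
    funext p
    split_ifs <;> norm_num
  rw [dualMatrix, transpose_mul, Matrix.mul_assoc, ← Matrix.mul_assoc _ (halfWeights k L (-1) 1),
    hW, Matrix.one_mul, transpose_submatrix,
    ← submatrix_mul _ _ _ _ _ Function.bijective_id, transpose_blockMatrix_mul_self]
  have hinj : Function.Injective (interiorIdx k L hL) := fun a b h => by
    simpa [interiorIdx, Fin.ext_iff] using h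
  rw [submatrix_diagonal _ _ hinj]
  congr 1
  funext m
  obtain ⟨l, rfl⟩ := Nat.exists_eq_add_of_le' hL
  have := m.isLt
  simp only [Nat.add_sub_cancel] at this
  rw [Function.comp_apply, if_pos, if_pos]
  · norm_num
  all_goals
    simp only [interiorIdx, Nat.add_mul, one_mul]
    omega

theorem transpose_blockMatrix_mul_dualMatrix (k L : ℕ) (hL : 1 ≤ L) :
    (blockMatrix k L)ᵀ * dualMatrix k L hL = 0 := by
  have h : (blockMatrix k L)ᵀ * dualMatrix k L hL
      = ((blockMatrix k L)ᵀ * halfWeights k L (-1) 1 * blockMatrix k L).submatrix id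
          (interiorIdx k L hL) := by
    rw [dualMatrix, ← Matrix.mul_assoc]
    rfl
  rw [h, transpose_blockMatrix_mul_halfWeights_mul]
  ext a m
  rw [submatrix_apply, diagonal_apply, id]
  split_ifs with ha h1 h2 h2 <;> try norm_num
  all_goals
    subst ha
    exfalso
    obtain ⟨l, rfl⟩ := Nat.exists_eq_add_of_le' hL
    have := m.isLt
    simp only [Nat.add_sub_cancel] at this
    simp only [interiorIdx, Nat.add_mul, one_mul] at h1 h2
    omega

theorem blockMatrix_mulVec (k L : ℕ) (x : Fin ((L+1)*k) → ℝ) (p : Fin (2*k) × Fin L) :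
    (blockMatrix k L *ᵥ x) p = x (blockIdx p.2 p.1) := by
  simp [blockMatrix, mulVec, dotProduct]

theorem dualMatrix_mulVec (k L : ℕ) (hL : 1 ≤ L) (ω : Fin ((L-1)*k) → ℝ)
    (p : Fin (2*k) × Fin L) :
    (dualMatrix k L hL *ᵥ ω) p = dualBlock k L ω p.2 p.1 := by
  have hext : (((blockMatrix k L).submatrix id (interiorIdx k L hL)) *ᵥ ω) p
      = extZero k L ω (blockIdx p.2 p.1) := by
    simp only [mulVec, dotProduct, submatrix_apply, id, blockMatrix, of_apply, ite_mul, one_mul,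
      zero_mul]
    unfold extZero
    obtain ⟨l, rfl⟩ := Nat.exists_eq_add_of_le' hL
    split_ifs with h
    · rw [Finset.sum_eq_single ⟨(blockIdx p.2 p.1 : ℕ) - k, _⟩, if_pos]
      · simp only [interiorIdx, Fin.ext_iff]
        omega
      · intro m _ hm
        refine if_neg fun h' => hm ?_
        simp [h', interiorIdx]
      · simp
    · refine Finset.sum_eq_zero fun m _ => if_neg fun h' => h ?_
      have := m.isLt
      simp only [Nat.add_sub_cancel] at this
      simp only [h', interiorIdx, Nat.add_mul, one_mul]
      omega
  rw [dualMatrix, ← mulVec_mulVec, halfWeights, mulVec_diagonal, hext]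
  unfold dualBlock
  split_ifs <;> simp

theorem dotProduct_transpose_mul_mul_mulVec {m n : Type*} [Fintype m] [Fintype n]
    (A : Matrix m n ℝ) (S : Matrix m m ℝ) (x : n → ℝ) :
    x ⬝ᵥ (Aᵀ * S * A) *ᵥ x = (A *ᵥ x) ⬝ᵥ S *ᵥ (A *ᵥ x) := by
  rw [Matrix.mul_assoc, ← mulVec_mulVec, ← mulVec_mulVec, dotProduct_mulVec, vecMul_transpose]

/-- **The normal factor graph duality theorem for the Gaussian ladder graph:**
the primal normalization constant
`Z = ∫_{ℝᴺ} ∏ℓ det(2π Sigl ℓ)^{-1/2} exp(−(1/2) vℓᵀ (Sigl ℓ)⁻¹ vℓ) dx`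
and the dual normalization constant
`Z' = (2π)^{2k} ∫_{ℝ^{(L−1)k}} ∏ℓ exp(−(1/2) vℓᵀ (Sigl ℓ) vℓ) dω`
both have convergent integrals and satisfy `Z' = (2π)^N Z`, `N = (L+1)k`. -/
theorem nfg_duality_gaussian_ladder (k L : ℕ) (hk : 1 ≤ k) (hL : 2 ≤ L)
    (Sigl : Fin L → Matrix (Fin (2*k)) (Fin (2*k)) ℝ)
    (hSigl : ∀ ℓ, (Sigl ℓ).PosDef) :
    Integrable (fun x : Fin ((L+1)*k) → ℝ =>
      ∏ ℓ : Fin L, (Real.sqrt (((2 * Real.pi) • Sigl ℓ).det))⁻¹ *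
        Real.exp (-(1/2) *
          ((fun i => x (blockIdx ℓ i)) ⬝ᵥ (Sigl ℓ)⁻¹ *ᵥ (fun i => x (blockIdx ℓ i))))) ∧
    Integrable (fun ω : Fin ((L-1)*k) → ℝ =>
      ∏ ℓ : Fin L,
        Real.exp (-(1/2) * (dualBlock k L ω ℓ ⬝ᵥ (Sigl ℓ) *ᵥ dualBlock k L ω ℓ))) ∧
    (2 * Real.pi) ^ (2*k) *
        (∫ ω : Fin ((L-1)*k) → ℝ,
          ∏ ℓ : Fin L,
            Real.exp (-(1/2) * (dualBlock k L ω ℓ ⬝ᵥ (Sigl ℓ) *ᵥ dualBlock k L ω ℓ)))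
      = (2 * Real.pi) ^ ((L+1)*k) *
        (∫ x : Fin ((L+1)*k) → ℝ,
          ∏ ℓ : Fin L, (Real.sqrt (((2 * Real.pi) • Sigl ℓ).det))⁻¹ *
            Real.exp (-(1/2) *
              ((fun i => x (blockIdx ℓ i)) ⬝ᵥ (Sigl ℓ)⁻¹ *ᵥ (fun i => x (blockIdx ℓ i))))) := by
  have hL1 : 1 ≤ L := by omega
  set A := blockMatrix k L
  set B := dualMatrix k L hL1
  set S := blockDiagonal Sigl
  have hS : S.PosDef := .blockDiagonal hSigl
  have hSinv : S⁻¹ = blockDiagonal fun l => (Sigl l)⁻¹ := by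
    refine inv_eq_right_inv ?_
    rw [← blockDiagonal_mul, ← blockDiagonal_one]
    congr 1
    funext l
    exact mul_nonsing_inv _ (isUnit_iff_ne_zero.2 (hSigl l).det_pos.ne')
  have hgramA : (Aᵀ * A).det = 2 ^ ((L-1)*k) := det_transpose_blockMatrix_mul_self k L hL1
  have hgramB : (Bᵀ * B).det = 2 ^ ((L-1)*k) := by
    rw [transpose_dualMatrix_mul_self, det_diagonal]
    simp
  have hA : (Aᵀ * A).det ≠ 0 := by rw [hgramA]; positivity
  have hB : (Bᵀ * B).det ≠ 0 := by rw [hgramB]; positivity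
  have hP : (Aᵀ * S⁻¹ * A).PosDef := by
    simpa using hS.inv.conjTranspose_mul_mul_same
      (mulVec_injective_of_det_transpose_mul_self_ne_zero hA)
  have hQ : (Bᵀ * S * B).PosDef := by
    simpa using hS.conjTranspose_mul_mul_same
      (mulVec_injective_of_det_transpose_mul_self_ne_zero hB)
  have hcard : Fintype.card (Fin ((L+1)*k) ⊕ Fin ((L-1)*k)) = Fintype.card (Fin (2*k) × Fin L) := by
    obtain ⟨l, rfl⟩ := Nat.exists_eq_add_of_le' hL1
    simp only [Fintype.card_sum, Fintype.card_prod, Fintype.card_fin, Nat.add_sub_cancel]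
    ring
  have hdet : (Aᵀ * S⁻¹ * A).det * S.det = (Bᵀ * S * B).det :=
    det_transpose_mul_inv_mul_mul_det (Fintype.equivOfCardEq hcard) hS
      (transpose_blockMatrix_mul_dualMatrix k L hL1) (hgramA.trans hgramB.symm) hA
  have hnorm : ∏ l : Fin L, (√((2 * π) • Sigl l).det)⁻¹
      = ((√(2 * π)) ^ (2 * k * L) * √S.det)⁻¹ := by
    have hsqrt (l : Fin L) : √((2 * π) • Sigl l).det = √(2 * π) ^ (2 * k) * √(Sigl l).det := by
      rw [det_smul, Fintype.card_fin, Real.sqrt_mul (by positivity)]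
      congr 1
      rw [Real.sqrt_eq_iff_mul_self_eq (by positivity) (by positivity), ← mul_pow,
        Real.mul_self_sqrt (by positivity)]
    simp_rw [Finset.prod_inv_distrib, hsqrt, Finset.prod_mul_distrib, Finset.prod_const,
      Finset.card_univ, Fintype.card_fin, ← pow_mul, S, det_blockDiagonal]
    rw [Real.sqrt_prod _ (fun l _ => (hSigl l).det_pos.le)]
  have hprimal : (fun x : Fin ((L+1)*k) → ℝ =>
      ∏ l : Fin L, (√((2 * π) • Sigl l).det)⁻¹ * Real.exp (-(1/2) *
          ((fun i => x (blockIdx l i)) ⬝ᵥ (Sigl l)⁻¹ *ᵥ (fun i => x (blockIdx l i)))))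
      = fun x => ((√(2 * π)) ^ (2 * k * L) * √S.det)⁻¹ *
          Real.exp (-(1/2) * (x ⬝ᵥ (Aᵀ * S⁻¹ * A) *ᵥ x)) := by
    funext x
    rw [Finset.prod_mul_distrib, hnorm, ← Real.exp_sum, ← Finset.mul_sum,
      dotProduct_transpose_mul_mul_mulVec, hSinv, dotProduct_blockDiagonal_mulVec]
    simp only [A, blockMatrix_mulVec]
  have hdual : (fun ω : Fin ((L-1)*k) → ℝ =>
      ∏ l : Fin L, Real.exp (-(1/2) * (dualBlock k L ω l ⬝ᵥ Sigl l *ᵥ dualBlock k L ω l)))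
      = fun ω => Real.exp (-(1/2) * (ω ⬝ᵥ (Bᵀ * S * B) *ᵥ ω)) := by
    funext ω
    rw [← Real.exp_sum, ← Finset.mul_sum, dotProduct_transpose_mul_mul_mulVec,
      dotProduct_blockDiagonal_mulVec]
    simp only [B, dualMatrix_mulVec]
  obtain ⟨hPi, hPv⟩ := integrable_and_integral_exp_neg_half_quadratic hP
  obtain ⟨hQi, hQv⟩ := integrable_and_integral_exp_neg_half_quadratic hQ
  rw [hprimal, hdual, integral_const_mul, hPv, hQv, ← hdet, Real.sqrt_mul hP.det_pos.le]
  refine ⟨hPi.const_mul _, hQi, ?_⟩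
  have h1 : 0 < √(Aᵀ * S⁻¹ * A).det := Real.sqrt_pos.2 hP.det_pos
  have h2 : 0 < √S.det := Real.sqrt_pos.2 hS.det_pos
  have h3 : 0 < √(2 * π) := by positivity
  have h4 : 2 * π = √(2 * π) ^ 2 := (Real.sq_sqrt (by positivity)).symm
  set r := √(2 * π)
  rw [h4, Fintype.card_fin, Fintype.card_fin]
  obtain ⟨l, rfl⟩ := Nat.exists_eq_add_of_le' hL1
  rw [Nat.add_sub_cancel]
  field_simp
  ring
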